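/- Let Γ ⊆ Iso(ℝⁿ_s) be a subgroup having the Wolf properties. Then Hol(Γ) is abelian if and only if U₀^⊥ = U_Γ^⊥, where U_Γ^⊥ = ⋂_{(I+A,v)∈Γ} ker A. -/

import Mathlib

noncomputable section

/-- `ℝⁿ` as a coordinate space. -/
abbrev E (n : ℕ) : Type := Fin n → ℝ

/-- The standard symmetric bilinear form of signature `(n-s, s)` on `ℝⁿ`. -/
def B (n s : ℕ) : LinearMap.BilinForm ℝ (E n) :=
  LinearMap.mk₂ ℝ
    (fun x y => ∑ i : Fin n, (if (i : ℕ) < n - s then x i * y i else -(x i * y i)))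
    (by
      intro x x' y
      rw [← Finset.sum_add_distrib]
      refine Finset.sum_congr rfl fun i _ => ?_
      by_cases h : (i : ℕ) < n - s <;> simp [h] <;> ring)
    (by
      intro c x y
      rw [Finset.smul_sum]
      refine Finset.sum_congr rfl fun i _ => ?_
      by_cases h : (i : ℕ) < n - s <;> simp [h] <;> ring)
    (by
      intro x y y'
      rw [← Finset.sum_add_distrib]
      refine Finset.sum_congr rfl fun i _ => ?_
      by_cases h : (i : ℕ) < n - s <;> simp [h] <;> ring)
    (by
      intro c x y
      rw [Finset.smul_sum]
      refine Finset.sum_congr rfl fun i _ => ?_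
      by_cases h : (i : ℕ) < n - s <;> simp [h] <;> ring)

/-- Orthogonal complement (w.r.t. the form `B n s`) of a set `S ⊆ ℝⁿ`. -/
def perp (n s : ℕ) (S : Set (E n)) : Set (E n) :=
  {x | ∀ w ∈ S, B n s x w = 0}

/-- A set of vectors is totally isotropic if the form vanishes identically on it. -/
def TotallyIsotropicSet (n s : ℕ) (U : Set (E n)) : Prop :=
  ∀ u ∈ U, ∀ u' ∈ U, B n s u u' = 0

/-- The set `T(D)` of translations preserving `D`. -/
def TransSet (n : ℕ) (D : Set (E n)) : Set (E n) :=
  {v | ∀ x ∈ D, v + x ∈ D}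

/-- `D` is translationally isotropic if `T(D)^⊥ ⊆ T(D)`. -/
def TranslationallyIsotropic (n s : ℕ) (D : Set (E n)) : Prop :=
  perp n s (TransSet n D) ⊆ TransSet n D

/-- The group of invertible affine transformations of `ℝⁿ`. -/
abbrev Aff (n : ℕ) : Type := (E n) ≃ᵃ[ℝ] (E n)

/-- The affine isometries of `ℝⁿ_s`: affine transformations whose linear part
preserves the bilinear form. -/
def Iso (n s : ℕ) : Set (Aff n) :=
  {g | ∀ x y : E n, B n s (g.linear x) (g.linear y) = B n s x y}

/-- For `γ = (I + A, v)`, the matrix `A`, i.e. the linear part minus the identity. -/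
def linA (n : ℕ) (γ : Aff n) : (E n) →ₗ[ℝ] (E n) :=
  γ.linear.toLinearMap - LinearMap.id

/-- The translation part `v` of an affine transformation. -/
def transPart (n : ℕ) (γ : Aff n) : E n := γ 0

/-- The Wolf properties of a single affine isometry `γ = (I + A, v)`:
`A² = 0`, `Av = 0`, `im A` totally isotropic, `v ⊥ im A`,
`im A = (ker A)^⊥` and `ker A = (im A)^⊥`. -/
def WolfElt (n s : ℕ) (γ : Aff n) : Prop :=
  linA n γ ∘ₗ linA n γ = 0 ∧
  linA n γ (transPart n γ) = 0 ∧
  TotallyIsotropicSet n s (LinearMap.range (linA n γ) : Set (E n)) ∧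
  transPart n γ ∈ perp n s (LinearMap.range (linA n γ) : Set (E n)) ∧
  (LinearMap.range (linA n γ) : Set (E n)) = perp n s (LinearMap.ker (linA n γ) : Set (E n)) ∧
  (LinearMap.ker (linA n γ) : Set (E n)) = perp n s (LinearMap.range (linA n γ) : Set (E n))

/-- The linear holonomy group `Hol(Γ)` (the group of linear parts) is abelian. -/
def HolAbelian (n : ℕ) (Γ : Subgroup (Aff n)) : Prop :=
  ∀ γ₁ ∈ Γ, ∀ γ₂ ∈ Γ,
    γ₁.linear.toLinearMap ∘ₗ γ₂.linear.toLinearMap =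
      γ₂.linear.toLinearMap ∘ₗ γ₁.linear.toLinearMap

/-- The centraliser of `Γ` in `Iso(ℝⁿ_s)`. -/
def CentrIso (n s : ℕ) (Γ : Subgroup (Aff n)) : Set (Aff n) :=
  {g ∈ Iso n s | ∀ γ ∈ Γ, g * γ = γ * g}

/-- The subspace `U_Γ = ∑_{(I+A,v) ∈ Γ} im A`. -/
def UGamma (n : ℕ) (Γ : Subgroup (Aff n)) : Submodule ℝ (E n) :=
  ⨆ γ ∈ Γ, LinearMap.range (linA n γ)

/-- The set `U₀ = U_Γ ∩ U_Γ^⊥`. -/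
def U0 (n s : ℕ) (Γ : Subgroup (Aff n)) : Set (E n) :=
  (UGamma n Γ : Set (E n)) ∩ perp n s (UGamma n Γ : Set (E n))

/-- The translation `τ_u : x ↦ u + x` as an affine transformation. -/
def τ (n : ℕ) (u : E n) : Aff n := AffineEquiv.constVAdd ℝ (E n) u


theorem B_symm (n s : ℕ) (x y : E n) : B n s x y = B n s y x := by
  simp only [B, LinearMap.mk₂_apply]
  refine Finset.sum_congr rfl fun i _ => ?_
  rw [mul_comm]

theorem perp_UGamma (n s : ℕ) (Γ : Subgroup (Aff n)) (hWolf : ∀ γ ∈ Γ, WolfElt n s γ) :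
    perp n s (UGamma n Γ : Set (E n)) =
      ⋂ γ ∈ Γ, (LinearMap.ker (linA n γ) : Set (E n)) := by
  ext x
  simp only [Set.mem_iInter]
  constructor
  · intro hx γ hγ
    rw [(hWolf γ hγ).2.2.2.2.2]
    intro w hw
    exact hx w ((le_iSup₂ (f := fun γ (_ : γ ∈ Γ) => LinearMap.range (linA n γ)) γ hγ) hw)
  · intro hx
    have : UGamma n Γ ≤ LinearMap.ker (B n s x) := by
      refine iSup₂_le fun γ hγ w hw => ?_
      have h := hx γ hγ
      rw [(hWolf γ hγ).2.2.2.2.2] at h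
      exact h w hw
    exact fun w hw => this hw

theorem anti_of_sq {R : Type*} [Ring R] (a b : R) (ha : a * a = 0) (hb : b * b = 0)
    (h : (a + b + a * b) * (a + b + a * b) = 0) : a * b + b * a = 0 := by
  have e : a * b + b * a + a * b * a + b * a * b + a * b * a * b = 0 := by
    calc _ = (a + b + a * b) * (a + b + a * b) - a * a - b * b - (a * a) * b - a * (b * b) := by
          noncomm_ring
      _ = 0 := by rw [h, ha, hb]; simp
  have e1 : a * b * a + a * b * a * b = 0 := by
    calc _ = a * (a * b + b * a + a * b * a + b * a * b + a * b * a * b)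
            - (a * a) * (b + b * a + b * a * b) := by noncomm_ring
      _ = 0 := by rw [e, ha]; simp
  have e2 : b * a * b + a * b * a * b = 0 := by
    calc _ = (a * b + b * a + a * b * a + b * a * b + a * b * a * b) * b
            - (a + b * a + a * b * a) * (b * b) := by noncomm_ring
      _ = 0 := by rw [e, hb]; simp
  have e3 : a * b * a * b = 0 := by
    calc _ = (a * b * a + a * b * a * b) * b - a * b * a * (b * b) := by noncomm_ring
      _ = 0 := by rw [e1, hb]; simp
  rw [e3, add_zero] at e1 e2 e
  rw [e1, e2, add_zero, add_zero] at e
  exact e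

theorem comm_sub_one {R : Type*} [Ring R] (a b : R) :
    (a - 1) * (b - 1) - (b - 1) * (a - 1) = a * b - b * a := by
  simp only [sub_mul, mul_sub, mul_one, one_mul]
  abel

theorem linA_anti (n s : ℕ) (Γ : Subgroup (Aff n)) (hWolf : ∀ γ ∈ Γ, WolfElt n s γ)
    (g k : Aff n) (hg : g ∈ Γ) (hk : k ∈ Γ) :
    (linA n g : Module.End ℝ (E n)) * linA n k + linA n k * linA n g = 0 := by
  refine anti_of_sq (R := Module.End ℝ (E n)) _ _ (hWolf g hg).1 (hWolf k hk).1 ?_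
  have h := (hWolf (g * k) (Γ.mul_mem hg hk)).1
  have e : (linA n (g * k) : Module.End ℝ (E n)) =
      linA n g + linA n k + (linA n g : Module.End ℝ (E n)) * linA n k := by
    ext1 x
    refine LinearMap.ext fun y => ?_
    have : (g * k).linear ((LinearMap.single ℝ (fun _ => ℝ) x) y) =
      g.linear (k.linear ((LinearMap.single ℝ (fun _ => ℝ) x) y)) := rfl
    simp [linA] at this ⊢
    rw [this]
  rw [e] at h
  exact h

theorem holAbelian_iff (n s : ℕ) (Γ : Subgroup (Aff n)) (hWolf : ∀ γ ∈ Γ, WolfElt n s γ) :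
    HolAbelian n Γ ↔ (UGamma n Γ : Set (E n)) ⊆ perp n s (UGamma n Γ : Set (E n)) := by
  have key : ∀ g k : Aff n, (g.linear.toLinearMap ∘ₗ k.linear.toLinearMap =
      k.linear.toLinearMap ∘ₗ g.linear.toLinearMap) ↔
      (linA n g : Module.End ℝ (E n)) * linA n k = linA n k * linA n g := by
    intro g k
    change (g.linear.toLinearMap : Module.End ℝ (E n)) * k.linear.toLinearMap =
      (k.linear.toLinearMap : Module.End ℝ (E n)) * g.linear.toLinearMap ↔
      ((g.linear.toLinearMap : Module.End ℝ (E n)) - 1) * (k.linear.toLinearMap - 1) =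
      ((k.linear.toLinearMap : Module.End ℝ (E n)) - 1) * (g.linear.toLinearMap - 1)
    generalize (g.linear.toLinearMap : Module.End ℝ (E n)) = a
    generalize (k.linear.toLinearMap : Module.End ℝ (E n)) = b
    rw [← sub_eq_zero, ← sub_eq_zero (a := (a - 1) * (b - 1))]
    have : (a - 1) * (b - 1) - (b - 1) * (a - 1) = a * b - b * a := comm_sub_one a b
    rw [this]
  rw [perp_UGamma n s Γ hWolf]
  constructor
  · intro h
    have : UGamma n Γ ≤ ⨅ γ ∈ Γ, LinearMap.ker (linA n γ) := by
      refine iSup₂_le fun k hk => le_iInf₂ fun g hg => ?_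
      rintro _ ⟨x, rfl⟩
      have h1 := (key g k).1 (h g hg k hk)
      have h2 := linA_anti n s Γ hWolf g k hg hk
      rw [← h1, ← two_smul ℝ] at h2
      have h3 := (smul_eq_zero.1 h2).resolve_left two_ne_zero
      exact LinearMap.congr_fun h3 x
    intro x hx
    simpa using this hx
  · intro h
    have z : ∀ g ∈ Γ, ∀ k ∈ Γ, (linA n g : Module.End ℝ (E n)) * linA n k = 0 := by
      intro g hg k hk
      refine LinearMap.ext fun x => ?_
      have hx : linA n k x ∈ UGamma n Γ :=
        (le_iSup₂ (f := fun γ (_ : γ ∈ Γ) => LinearMap.range (linA n γ)) k hk) ⟨x, rfl⟩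
      exact Set.mem_iInter₂.1 (h hx) g hg
    intro g hg k hk
    rw [key, z g hg k hk, z k hk g hg]

/-- For a subgroup `Γ ⊆ Iso(ℝⁿ_s)` with the Wolf properties,
`Hol(Γ)` is abelian if and only if `U₀^⊥ = U_Γ^⊥`, where
`U_Γ^⊥ = ⋂_{(I+A,v) ∈ Γ} ker A`. -/
theorem holonomy_abelian_iff_perpU0_eq_perpUGamma
    (n s : ℕ) (hn : 1 ≤ n) (hs : s ≤ n)
    (Γ : Subgroup (Aff n)) (hΓIso : (Γ : Set (Aff n)) ⊆ Iso n s)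
    (hWolf : ∀ γ ∈ Γ, WolfElt n s γ) :
    HolAbelian n Γ ↔
      perp n s (U0 n s Γ) = ⋂ γ ∈ Γ, (LinearMap.ker (linA n γ) : Set (E n)) := by
  rw [holAbelian_iff n s Γ hWolf, ← perp_UGamma n s Γ hWolf]
  constructor
  · intro h
    rw [U0, Set.inter_eq_left.2 h]
  · intro h
    rw [← h]
    intro x hx w hw
    rw [B_symm]
    exact hw.2 x hx

end
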